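/- Concentration of the energy score empirical loss: Assume X ⊆ ℝ^d is bounded with sup_{x,y∈X} ‖x−y‖₂ ≤ B < ∞ and let β ∈ (0,2). Let L(θ, Y_1,…,Y_n) = (2/n) Σ_{i=1}^n E_{X∼P_θ}[‖X − Y_i‖₂^β] − (1/(n(n−1))) Σ_{i≠j} ‖Y_i − Y_j‖₂^β − E_{X,X'∼P_θ}[‖X − X'‖₂^β], and let D_E^β(P_θ, P_0) be the divergence associated to the energy score. Then for Y_1,…,Y_n i.i.d. with law P_0 and any δ ∈ (0,1], P_0( |L(θ, Y_1,…,Y_n) − D_E^β(P_θ, P_0)| ≤ √( −(32 B^{2β}/n) log(δ/2) ) ) ≥ 1 − δ. -/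

import Mathlib

open MeasureTheory Finset
open scoped ENNReal

namespace EnergyAux

open ProbabilityTheory

variable {E : Type*} [MeasurableSpace E]

lemma integrable_of_bdd {Ω : Type*} [MeasurableSpace Ω] (μ : Measure Ω) [IsFiniteMeasure μ]
    {f : Ω → ℝ} (hf : Measurable f) (M : ℝ) (hM : ∀ x, |f x| ≤ M) : Integrable f μ :=
  Integrable.of_bound hf.aestronglyMeasurable M (Filter.Eventually.of_forall hM)

lemma abs_integral_le {Ω : Type*} [MeasurableSpace Ω] (μ : Measure Ω) [IsProbabilityMeasure μ]
    {f : Ω → ℝ} (M : ℝ) (hM : ∀ x, |f x| ≤ M) : |∫ x, f x ∂μ| ≤ M := by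
  have := norm_integral_le_of_norm_le_const (μ := μ) (f := f) (C := M)
    (Filter.Eventually.of_forall hM)
  simpa using this

lemma measurable_cons (n : ℕ) :
    Measurable (fun p : E × (Fin n → E) => (Fin.cons p.1 p.2 : Fin (n + 1) → E)) := by
  refine measurable_pi_lambda _ (fun i => ?_)
  refine Fin.cases ?_ (fun j => ?_) i
  · simpa using measurable_fst
  · simp only [Fin.cons_succ]
    fun_prop

lemma integral_cons (μ : Measure E) [IsProbabilityMeasure μ] (n : ℕ)
    (G : (Fin (n + 1) → E) → ℝ) (hG : Measurable G) (M : ℝ) (hM : ∀ x, |G x| ≤ M) :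
    ∫ x, G x ∂(Measure.pi fun _ : Fin (n + 1) => μ)
      = ∫ y, ∫ z, G (Fin.cons y z) ∂(Measure.pi fun _ : Fin n => μ) ∂μ := by
  have h := (measurePreserving_piFinSuccAbove (fun _ : Fin (n + 1) => μ) 0).symm
  rw [← h.integral_comp' G]
  simp only [MeasurableEquiv.piFinSuccAbove_symm_apply, Fin.insertNthEquiv_zero]
  have hi : Integrable (fun p : E × (Fin n → E) => G (Fin.cons p.1 p.2))
      (μ.prod (Measure.pi fun _ : Fin n => μ)) :=
    integrable_of_bdd _ (hG.comp (measurable_cons n)) M (fun _ => hM _)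
  exact integral_prod _ hi

lemma exp_bdd {a M t : ℝ} (h : |a| ≤ M) : |Real.exp (t * a)| ≤ Real.exp (|t| * M) := by
  rw [Real.abs_exp]
  apply Real.exp_le_exp.2
  calc t * a ≤ |t * a| := le_abs_self _
    _ = |t| * |a| := abs_mul _ _
    _ ≤ _ := by gcongr

/-- The McDiarmid inequality (moment generating function form, crude constant). -/
lemma mcdiarmid (μ : Measure E) [IsProbabilityMeasure μ] (c : ℝ) (hc : 0 ≤ c) (t : ℝ) (n : ℕ) :
    ∀ (f : (Fin n → E) → ℝ) (_ : Measurable f) (M : ℝ) (_ : ∀ x, |f x| ≤ M)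
      (_ : ∀ x i y, |f (Function.update x i y) - f x| ≤ c),
    ∫ x, Real.exp (t * (f x - ∫ x, f x ∂(Measure.pi fun _ : Fin n => μ)))
      ∂(Measure.pi fun _ : Fin n => μ) ≤ Real.exp (n * c ^ 2 * t ^ 2 / 2) := by
  induction n with
  | zero =>
    intro f hf M hM hd
    have h0 : ∀ x, f x = f default := fun x => by rw [Subsingleton.elim x default]
    simp [h0]
  | succ n ih =>
    intro f hf M hM hd
    set ν := Measure.pi fun _ : Fin n => μ with hν
    set m := ∫ x, f x ∂(Measure.pi fun _ : Fin (n + 1) => μ) with hm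
    set g : E → ℝ := fun y => ∫ z, f (Fin.cons y z) ∂ν with hg
    have hF : Measurable (fun p : E × (Fin n → E) => f (Fin.cons p.1 p.2)) :=
      hf.comp (measurable_cons n)
    have hFy : ∀ y, Measurable (fun z : Fin n → E => f (Fin.cons y z)) :=
      fun y => hF.comp measurable_prodMk_left
    have hgm : Measurable g := by
      have : StronglyMeasurable (Function.uncurry fun (y : E) (z : Fin n → E) =>
        f (Fin.cons y z)) := hF.stronglyMeasurable
      exact (this.integral_prod_right (ν := ν)).measurable
    have hgM : ∀ y, |g y| ≤ M := fun y => abs_integral_le ν M (fun _ => hM _)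
    have hmg : m = ∫ y, g y ∂μ := integral_cons μ n f hf M hM
    have hmM : |m| ≤ M := abs_integral_le _ M hM
    have hFi : ∀ y, Integrable (fun z : Fin n → E => f (Fin.cons y z)) ν :=
      fun y => integrable_of_bdd _ (hFy y) M (fun _ => hM _)
    have hgd : ∀ y y', |g y' - g y| ≤ c := by
      intro y y'
      simp only [hg]
      rw [← integral_sub (hFi y') (hFi y)]
      refine abs_integral_le ν c (fun z => ?_)
      have := hd (Fin.cons y z) 0 y'
      rwa [Fin.update_cons_zero] at this
    have hgint : Integrable g μ := integrable_of_bdd _ hgm M hgM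
    have hgc : ∀ y, |g y - m| ≤ c := by
      intro y
      have : g y - m = ∫ y', (g y - g y') ∂μ := by
        rw [integral_sub (integrable_const _) hgint, hmg]; simp
      rw [this]
      exact abs_integral_le μ c (fun y' => hgd y' y)
    have hsub := hasSubgaussianMGF_of_mem_Icc_of_integral_eq_zero (μ := μ)
      (X := fun y => g y - m) (a := -c) (b := c) (hgm.sub_const m).aemeasurable
      (Filter.Eventually.of_forall fun y => abs_le.1 (hgc y))
      (by rw [integral_sub hgint (integrable_const _), hmg]; simp)
    have hout := hsub.mgf_le t
    have hcc : (((‖c - -c‖₊ / 2) ^ 2 : NNReal) : ℝ) = c ^ 2 := by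
      have : c - -c = 2 * c := by ring
      simp [this]
    rw [hcc] at hout
    simp only [mgf] at hout
    have hMd : ∀ x, |f x - m| ≤ M + M := fun x =>
      (abs_sub _ _).trans (add_le_add (hM x) hmM)
    rw [integral_cons μ n (fun x => Real.exp (t * (f x - m)))
      (by fun_prop) (Real.exp (|t| * (M + M))) (fun x => exp_bdd (hMd x))]
    have hin : ∀ y, ∫ z, Real.exp (t * (f (Fin.cons y z) - m)) ∂ν
        ≤ Real.exp (n * c ^ 2 * t ^ 2 / 2) * Real.exp (t * (g y - m)) := by
      intro y
      have h1 := ih (fun z => f (Fin.cons y z)) (hFy y) M (fun _ => hM _) (by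
        intro x i y'
        simp only [Fin.cons_update]
        exact hd _ _ _)
      have h2 : ∀ z : Fin n → E, Real.exp (t * (f (Fin.cons y z) - m))
          = Real.exp (t * (f (Fin.cons y z) - g y)) * Real.exp (t * (g y - m)) := by
        intro z; rw [← Real.exp_add]; ring_nf
      simp only [h2]
      rw [integral_mul_const]
      exact mul_le_mul_of_nonneg_right h1 (Real.exp_pos _).le
    have hbi : Integrable (fun y => Real.exp (n * c ^ 2 * t ^ 2 / 2) * Real.exp (t * (g y - m))) μ :=
      (hsub.integrable_exp_mul t).const_mul _
    calc _ ≤ ∫ y, Real.exp (n * c ^ 2 * t ^ 2 / 2) * Real.exp (t * (g y - m)) ∂μ := by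
            refine integral_mono_of_nonneg (Filter.Eventually.of_forall fun y => ?_) hbi
              (Filter.Eventually.of_forall hin)
            exact integral_nonneg fun _ => (Real.exp_pos _).le
      _ ≤ Real.exp (n * c ^ 2 * t ^ 2 / 2) * Real.exp (c ^ 2 * t ^ 2 / 2) := by
            rw [integral_const_mul]
            exact mul_le_mul_of_nonneg_left hout (Real.exp_pos _).le
      _ = _ := by
            rw [← Real.exp_add]; push_cast; ring_nf

lemma mcdiarmid_sub (μ : Measure E) [IsProbabilityMeasure μ] (c : NNReal) (n : ℕ)
    (f : (Fin n → E) → ℝ) (hf : Measurable f) (M : ℝ) (hM : ∀ x, |f x| ≤ M)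
    (hd : ∀ x i y, |f (Function.update x i y) - f x| ≤ c) (m : ℝ)
    (hm : ∫ x, f x ∂(Measure.pi fun _ : Fin n => μ) = m) :
    HasSubgaussianMGF (fun x => f x - m) (n * c ^ 2) (Measure.pi fun _ : Fin n => μ) := by
  subst hm
  refine ⟨fun t => ?_, fun t => ?_⟩
  · refine integrable_of_bdd _ (by fun_prop) (Real.exp (|t| * (M + M))) (fun x => exp_bdd ?_)
    exact (abs_sub _ _).trans (add_le_add (hM x) (abs_integral_le _ M hM))
  · simpa [mgf] using mcdiarmid μ c c.2 t n f hf M hM hd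

lemma two_sided {Ω : Type*} [MeasurableSpace Ω] (μ : Measure Ω) [IsProbabilityMeasure μ]
    (Z : Ω → ℝ) (hZ : Measurable Z) (s : NNReal) (h : HasSubgaussianMGF Z s μ) (δ : ℝ)
    (hδ : δ ∈ Set.Ioc (0 : ℝ) 1) :
    ENNReal.ofReal (1 - δ) ≤ μ {ω | |Z ω| ≤ Real.sqrt (-(2 * s) * Real.log (δ / 2))} := by
  set ε := Real.sqrt (-(2 * s) * Real.log (δ / 2)) with hε
  have hε0 : 0 ≤ ε := Real.sqrt_nonneg _
  by_cases hs : s = 0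
  · subst hs
    have h0 := h.ae_eq_zero_of_hasSubgaussianMGF_zero
    have : μ {ω | |Z ω| ≤ ε} = 1 := by
      refine le_antisymm prob_le_one ?_
      rw [← measure_univ (μ := μ)]
      refine measure_mono_ae ?_
      filter_upwards [h0] with ω hω _
      change |Z ω| ≤ ε
      simpa [hω] using hε0
    rw [this]
    exact ENNReal.ofReal_le_one.2 (by linarith [hδ.1])
  · have hs' : (0 : ℝ) < s := by positivity
    have hlog : Real.log (δ / 2) ≤ 0 :=
      Real.log_nonpos (by linarith [hδ.1]) (by linarith [hδ.2])
    have hsq : ε ^ 2 = -(2 * s) * Real.log (δ / 2) :=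
      Real.sq_sqrt (by nlinarith)
    have he : Real.exp (-ε ^ 2 / (2 * s)) = δ / 2 := by
      rw [hsq]
      have : -(-(2 * (s : ℝ)) * Real.log (δ / 2)) / (2 * s) = Real.log (δ / 2) := by
        field_simp
      rw [this, Real.exp_log (by linarith [hδ.1])]
    have h1 := h.measure_ge_le hε0
    have h2 := h.neg.measure_ge_le hε0
    rw [he] at h1 h2
    have hms : MeasurableSet {ω | |Z ω| ≤ ε} := measurableSet_le hZ.abs measurable_const
    have hc : μ.real {ω | |Z ω| ≤ ε}ᶜ ≤ δ := by
      calc _ ≤ μ.real ({ω | ε ≤ Z ω} ∪ {ω | ε ≤ (-Z) ω}) := by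
            refine measureReal_mono (fun ω hω => ?_)
            simp only [Set.mem_compl_iff, Set.mem_ofPred_eq, not_le] at hω
            rcases lt_abs.1 hω with h | h
            · exact Or.inl h.le
            · exact Or.inr h.le
        _ ≤ _ := measureReal_union_le _ _
        _ ≤ δ := by linarith
    rw [probReal_compl_eq_one_sub hms] at hc
    rw [ENNReal.ofReal_le_iff_le_toReal (measure_ne_top _ _)]
    change _ ≤ μ.real _
    linarith

/-- The empirical loss for a general kernel. -/
noncomputable def loss (k : E → E → ℝ) (P : Measure E) (n : ℕ) (ys : Fin n → E) : ℝ :=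
  (2 / (n : ℝ)) * ∑ i, (∫ x, k x (ys i) ∂P)
    - ((n : ℝ) * ((n : ℝ) - 1))⁻¹ * ∑ i, ∑ j ∈ Finset.univ.erase i, k (ys i) (ys j)
    - ∫ x, ∫ x', k x x' ∂P ∂P

lemma measurable_h (k : E → E → ℝ) (hk : Measurable (Function.uncurry k)) (P : Measure E) [IsProbabilityMeasure P]
    : Measurable (fun y => ∫ x, k x y ∂P) := by
  have : StronglyMeasurable (Function.uncurry k) := hk.stronglyMeasurable
  exact (this.integral_prod_left' (μ := P)).measurable

lemma measurable_pair (k : E → E → ℝ) (hk : Measurable (Function.uncurry k)) (n : ℕ)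
    (i j : Fin n) : Measurable (fun ys : Fin n → E => k (ys i) (ys j)) := by
  have h : Measurable (fun ys : Fin n → E => (ys i, ys j)) :=
    (measurable_pi_apply i).prodMk (measurable_pi_apply j)
  exact hk.comp h

lemma measurable_loss (k : E → E → ℝ) (hk : Measurable (Function.uncurry k)) (P : Measure E) [IsProbabilityMeasure P] (n : ℕ)
    : Measurable (loss k P n) := by
  unfold loss
  have h1 := measurable_h k hk P
  have h2 : ∀ i j : Fin n, Measurable (fun ys : Fin n → E => k (ys i) (ys j)) := fun i j =>
    measurable_pair k hk n i j
  have h3 : ∀ i : Fin n, Measurable (fun ys : Fin n → E => ∫ x, k x (ys i) ∂P) := fun i =>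
    h1.comp (measurable_pi_apply i)
  refine ((Measurable.const_mul ?_ _).sub (Measurable.const_mul ?_ _)).sub_const _
  · exact Finset.measurable_sum _ (fun i _ => h3 i)
  · exact Finset.measurable_sum _ (fun i _ => Finset.measurable_sum _ (fun j _ => h2 i j))

lemma h_bound (k : E → E → ℝ) (K : ℝ) (hk0 : ∀ x y, 0 ≤ k x y) (hkK : ∀ x y, k x y ≤ K) (P : Measure E) [IsProbabilityMeasure P]
    (y : E) : 0 ≤ ∫ x, k x y ∂P ∧ ∫ x, k x y ∂P ≤ K := by
  refine ⟨integral_nonneg fun x => hk0 x y, ?_⟩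
  refine (le_abs_self _).trans (abs_integral_le P K fun x => ?_)
  rw [abs_of_nonneg (hk0 _ _)]; exact hkK _ _

lemma loss_diff (k : E → E → ℝ) (K : ℝ) (hk0 : ∀ x y, 0 ≤ k x y) (hkK : ∀ x y, k x y ≤ K) (P : Measure E) [IsProbabilityMeasure P] (n : ℕ)
    (hn : 2 ≤ n) (ys : Fin n → E) (l : Fin n) (y : E) :
    |loss k P n (Function.update ys l y) - loss k P n ys| ≤ 4 * K / n := by
  have hK : 0 ≤ K := (hk0 y y).trans (hkK y y)
  have hn' : (2 : ℝ) ≤ n := by exact_mod_cast hn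
  set zs := Function.update ys l y with hzs
  have hz : ∀ i, i ≠ l → zs i = ys i := fun i hi => Function.update_of_ne hi _ _
  set A : (Fin n → E) → ℝ := fun ys => ∑ i, (∫ x, k x (ys i) ∂P) with hA
  set S : (Fin n → E) → ℝ := fun ys => ∑ i, ∑ j ∈ Finset.univ.erase i, k (ys i) (ys j) with hS
  have h1 : |A zs - A ys| ≤ K := by
    simp only [hA]
    rw [← Finset.sum_sub_distrib]
    refine (Finset.abs_sum_le_sum_abs _ _).trans ?_
    calc _ ≤ ∑ i, (if i = l then K else 0) := by
          refine Finset.sum_le_sum fun i _ => ?_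
          split_ifs with h
          · have a := h_bound k K hk0 hkK P (zs i)
            have b := h_bound k K hk0 hkK P (ys i)
            rw [abs_le]; constructor <;> linarith [a.1, a.2, b.1, b.2]
          · rw [hz i h]; simp
      _ = K := by simp
  have h2 : |S zs - S ys| ≤ 2 * (n - 1) * K := by
    simp only [hS]
    rw [← Finset.sum_sub_distrib]
    refine (Finset.abs_sum_le_sum_abs _ _).trans ?_
    calc _ ≤ ∑ i, ∑ j ∈ Finset.univ.erase i,
              ((if i = l then K else 0) + (if j = l then K else 0)) := by
          refine Finset.sum_le_sum fun i _ => ?_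
          rw [← Finset.sum_sub_distrib]
          refine (Finset.abs_sum_le_sum_abs _ _).trans (Finset.sum_le_sum fun j _ => ?_)
          have a := hk0 (zs i) (zs j)
          have a' := hkK (zs i) (zs j)
          have b := hk0 (ys i) (ys j)
          have b' := hkK (ys i) (ys j)
          have hab : |k (zs i) (zs j) - k (ys i) (ys j)| ≤ K := by
            rw [abs_le]; constructor <;> linarith
          by_cases hi : i = l
          · by_cases hj : j = l
            · rw [if_pos hi, if_pos hj]; linarith
            · rw [if_pos hi, if_neg hj]; linarith
          · by_cases hj : j = l
            · rw [if_neg hi, if_pos hj]; linarith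
            · rw [if_neg hi, if_neg hj, hz i hi, hz j hj]; simp
      _ = ∑ i : Fin n, ((n - 1 : ℝ) * (if i = l then K else 0) + (K - if i = l then K else 0)) := by
          refine Finset.sum_congr rfl fun i _ => ?_
          rw [Finset.sum_add_distrib, Finset.sum_const, Finset.card_erase_of_mem (Finset.mem_univ i),
            Finset.card_univ, Fintype.card_fin, nsmul_eq_mul, Nat.cast_sub (by omega)]
          have : ∑ j ∈ Finset.univ.erase i, (if j = l then K else 0) = K - if i = l then K else 0 := by
            rw [eq_sub_iff_add_eq, Finset.sum_erase_add _ _ (Finset.mem_univ i)]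
            simp
          rw [this]; simp
      _ = _ := by
          rw [Finset.sum_add_distrib, ← Finset.mul_sum, Finset.sum_sub_distrib]
          simp; ring
  have e : loss k P n zs - loss k P n ys = (2 / (n : ℝ)) * (A zs - A ys)
      - ((n : ℝ) * ((n : ℝ) - 1))⁻¹ * (S zs - S ys) := by
    simp only [loss, hA, hS]; ring
  rw [e]
  have hp1 : 0 < (n : ℝ) := by linarith
  have hp2 : 0 < (n : ℝ) - 1 := by linarith
  calc _ ≤ |(2 / (n : ℝ)) * (A zs - A ys)| + |((n : ℝ) * ((n : ℝ) - 1))⁻¹ * (S zs - S ys)| :=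
        abs_sub _ _
    _ = (2 / (n : ℝ)) * |A zs - A ys| + ((n : ℝ) * ((n : ℝ) - 1))⁻¹ * |S zs - S ys| := by
        rw [abs_mul, abs_mul, abs_of_pos (by positivity : 0 < 2 / (n : ℝ)),
          abs_of_pos (by positivity : 0 < ((n : ℝ) * ((n : ℝ) - 1))⁻¹)]
    _ ≤ (2 / (n : ℝ)) * K + ((n : ℝ) * ((n : ℝ) - 1))⁻¹ * (2 * (n - 1) * K) := by gcongr
    _ = _ := by field_simp; ring

lemma k_abs (k : E → E → ℝ) (K : ℝ) (hk0 : ∀ x y, 0 ≤ k x y) (hkK : ∀ x y, k x y ≤ K)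
    (x y : E) : |k x y| ≤ K := by rw [abs_of_nonneg (hk0 x y)]; exact hkK x y

lemma h_abs (k : E → E → ℝ) (K : ℝ) (hk0 : ∀ x y, 0 ≤ k x y) (hkK : ∀ x y, k x y ≤ K) (P : Measure E) [IsProbabilityMeasure P]
    (y : E) : |∫ x, k x y ∂P| ≤ K :=
  abs_integral_le P K fun x => k_abs k K hk0 hkK x y

lemma loss_bdd (k : E → E → ℝ) (K : ℝ) (hk0 : ∀ x y, 0 ≤ k x y) (hkK : ∀ x y, k x y ≤ K) (P : Measure E) [IsProbabilityMeasure P] (n : ℕ)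
    : ∃ M, ∀ ys, |loss k P n ys| ≤ M := by
  refine ⟨|2 / (n : ℝ)| * (∑ _i : Fin n, K) + |((n : ℝ) * ((n : ℝ) - 1))⁻¹| *
    (∑ i : Fin n, ∑ _j ∈ Finset.univ.erase i, K) + K, fun ys => ?_⟩
  unfold loss
  refine (abs_sub _ _).trans (add_le_add ((abs_sub _ _).trans (add_le_add ?_ ?_)) ?_)
  · rw [abs_mul]
    gcongr
    exact (Finset.abs_sum_le_sum_abs _ _).trans
      (Finset.sum_le_sum fun i _ => h_abs k K hk0 hkK P _)
  · rw [abs_mul]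
    gcongr
    exact (Finset.abs_sum_le_sum_abs _ _).trans
      (Finset.sum_le_sum fun i _ => (Finset.abs_sum_le_sum_abs _ _).trans
      (Finset.sum_le_sum fun i _ => k_abs k K hk0 hkK _ _))
  · exact abs_integral_le P K fun x => abs_integral_le P K fun x' => k_abs k K hk0 hkK _ _

lemma integral_pair (k : E → E → ℝ) (hk : Measurable (Function.uncurry k)) (K : ℝ) (hk0 : ∀ x y, 0 ≤ k x y) (hkK : ∀ x y, k x y ≤ K) (Q : Measure E) [IsProbabilityMeasure Q] (n : ℕ)
    (i j : Fin n) (hij : i ≠ j) :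
    ∫ ys, k (ys i) (ys j) ∂(Measure.pi fun _ : Fin n => Q) = ∫ y, ∫ y', k y y' ∂Q ∂Q := by
  have hind : iIndepFun (fun (i : Fin n) (ω : Fin n → E) => ω i) (Measure.pi fun _ : Fin n => Q) :=
    iIndepFun_pi (X := fun _ : Fin n => (id : E → E)) (fun _ => aemeasurable_id)
  have h2 := (indepFun_iff_map_prod_eq_prod_map_map (measurable_pi_apply i).aemeasurable
    (measurable_pi_apply j).aemeasurable).1 (hind.indepFun hij)
  have hmi : ∀ i : Fin n, Measure.map (fun ω : Fin n → E => ω i) (Measure.pi fun _ : Fin n => Q)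
      = Q := fun i => (measurePreserving_eval (fun _ : Fin n => Q) i).map_eq
  rw [hmi, hmi] at h2
  have h3 : ∫ p, Function.uncurry k p ∂(Q.prod Q) = ∫ y, ∫ y', k y y' ∂Q ∂Q :=
    integral_prod _ (integrable_of_bdd _ hk K fun p => k_abs k K hk0 hkK p.1 p.2)
  rw [← h3, ← h2, integral_map ((measurable_pi_apply i).prodMk (measurable_pi_apply j)).aemeasurable
    hk.aestronglyMeasurable]
  rfl

lemma integral_single (k : E → E → ℝ) (hk : Measurable (Function.uncurry k)) (K : ℝ) (hk0 : ∀ x y, 0 ≤ k x y) (hkK : ∀ x y, k x y ≤ K) (P : Measure E) [IsProbabilityMeasure P] (Q : Measure E) [IsProbabilityMeasure Q] (n : ℕ)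
    (i : Fin n) :
    ∫ ys, (∫ x, k x (ys i) ∂P) ∂(Measure.pi fun _ : Fin n => Q) = ∫ x, ∫ y, k x y ∂Q ∂P := by
  have hp := measurePreserving_eval (fun _ : Fin n => Q) i
  have h1 := measurable_h k hk P
  have h2 : ∫ ys, (∫ x, k x (ys i) ∂P) ∂(Measure.pi fun _ : Fin n => Q)
      = ∫ y, ∫ x, k x y ∂P ∂Q := by
    conv_rhs => rw [← hp.map_eq]
    rw [integral_map hp.measurable.aemeasurable h1.aestronglyMeasurable]
  rw [h2]
  exact (integral_integral_swap
    (integrable_of_bdd (P.prod Q) hk K fun p => k_abs k K hk0 hkK p.1 p.2)).symm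

lemma integral_loss (k : E → E → ℝ) (hk : Measurable (Function.uncurry k)) (K : ℝ) (hk0 : ∀ x y, 0 ≤ k x y) (hkK : ∀ x y, k x y ≤ K) (P : Measure E) [IsProbabilityMeasure P] (Q : Measure E) [IsProbabilityMeasure Q] (n : ℕ)
    (hn : 2 ≤ n) :
    ∫ ys, loss k P n ys ∂(Measure.pi fun _ : Fin n => Q) =
      2 * (∫ x, ∫ y, k x y ∂Q ∂P) - (∫ x, ∫ x', k x x' ∂P ∂P) - ∫ y, ∫ y', k y y' ∂Q ∂Q := by
  have hn' : (2 : ℝ) ≤ n := by exact_mod_cast hn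
  have h1 := measurable_h k hk P
  have i1 : ∀ i : Fin n, Integrable (fun ys : Fin n → E => ∫ x, k x (ys i) ∂P)
      (Measure.pi fun _ : Fin n => Q) := fun i =>
    integrable_of_bdd _ (h1.comp (measurable_pi_apply i)) K fun ys => h_abs k K hk0 hkK P _
  have i2 : ∀ i j : Fin n, Integrable (fun ys : Fin n → E => k (ys i) (ys j))
      (Measure.pi fun _ : Fin n => Q) := fun i j =>
    integrable_of_bdd _ (measurable_pair k hk n i j) K
      fun ys => k_abs k K hk0 hkK _ _
  have j1 : Integrable (fun ys : Fin n → E => ∑ i, ∫ x, k x (ys i) ∂P)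
      (Measure.pi fun _ : Fin n => Q) := integrable_finsetSum _ fun i _ => i1 i
  have j2' : ∀ i : Fin n, Integrable (fun ys : Fin n → E =>
      ∑ j ∈ Finset.univ.erase i, k (ys i) (ys j))
      (Measure.pi fun _ : Fin n => Q) := fun i => integrable_finsetSum _ fun j _ => i2 i j
  have j2 : Integrable (fun ys : Fin n → E => ∑ i, ∑ j ∈ Finset.univ.erase i, k (ys i) (ys j))
      (Measure.pi fun _ : Fin n => Q) := integrable_finsetSum _ fun i _ => j2' i
  have j3 : Integrable (fun ys : Fin n → E => (2 / (n : ℝ)) * ∑ i, (∫ x, k x (ys i) ∂P)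
      - ((n : ℝ) * ((n : ℝ) - 1))⁻¹ * ∑ i, ∑ j ∈ Finset.univ.erase i, k (ys i) (ys j))
      (Measure.pi fun _ : Fin n => Q) := (j1.const_mul _).sub (j2.const_mul _)
  unfold loss
  rw [integral_sub j3 (integrable_const _),
    integral_sub (j1.const_mul _) (j2.const_mul _), integral_const_mul, integral_const_mul,
    integral_finsetSum _ (fun i _ => i1 i), integral_finsetSum _ (fun i _ => j2' i)]
  have e2 : ∀ i : Fin n, ∫ ys, ∑ j ∈ Finset.univ.erase i, k (ys i) (ys j)
      ∂(Measure.pi fun _ : Fin n => Q) = (n - 1 : ℝ) * ∫ y, ∫ y', k y y' ∂Q ∂Q := by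
    intro i
    rw [integral_finsetSum _ (fun j _ => i2 i j), Finset.sum_congr rfl (fun j hj =>
      integral_pair k hk K hk0 hkK Q n i j (Finset.ne_of_mem_erase hj).symm),
      Finset.sum_const, Finset.card_erase_of_mem (Finset.mem_univ i),
      Finset.card_univ, Fintype.card_fin, nsmul_eq_mul, Nat.cast_sub (by omega)]
    simp
  simp only [e2, integral_single k hk K hk0 hkK P Q n]
  have hp1 : (n : ℝ) ≠ 0 := by linarith
  have hp2 : (n : ℝ) - 1 ≠ 0 := by linarith
  simp
  field_simp
  ring

lemma loss_conc (k : E → E → ℝ) (hk : Measurable (Function.uncurry k)) (K : ℝ) (hk0 : ∀ x y, 0 ≤ k x y) (hkK : ∀ x y, k x y ≤ K) (P : Measure E) [IsProbabilityMeasure P] (Q : Measure E) [IsProbabilityMeasure Q] (n : ℕ)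
    (hn : 2 ≤ n) (δ : ℝ) (hδ : δ ∈ Set.Ioc (0 : ℝ) 1) :
    ENNReal.ofReal (1 - δ) ≤ (Measure.pi fun _ : Fin n => Q)
      {ys | |loss k P n ys - (2 * (∫ x, ∫ y, k x y ∂Q ∂P) - (∫ x, ∫ x', k x x' ∂P ∂P)
        - ∫ y, ∫ y', k y y' ∂Q ∂Q)| ≤ Real.sqrt (-(32 * K ^ 2 / n) * Real.log (δ / 2))} := by
  have hE : Nonempty E := Q.nonempty_of_neZero
  obtain ⟨y⟩ := hE
  have hK : 0 ≤ K := (hk0 y y).trans (hkK y y)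
  have hn' : (2 : ℝ) ≤ n := by exact_mod_cast hn
  obtain ⟨M, hM⟩ := loss_bdd k K hk0 hkK P n
  have hc : 0 ≤ 4 * K / n := by positivity
  have h := mcdiarmid_sub Q ⟨4 * K / n, hc⟩ n (loss k P n) (measurable_loss k hk P n) M hM
    (loss_diff k K hk0 hkK P n hn) _ (integral_loss k hk K hk0 hkK P Q n hn)
  have h2 := two_sided _ _ ((measurable_loss k hk P n).sub_const _) _ h δ hδ
  have e : 2 * (((n : NNReal) * ⟨4 * K / n, hc⟩ ^ 2 : NNReal) : ℝ) = 32 * K ^ 2 / n := by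
    push_cast
    change 2 * ((n : ℝ) * (4 * K / n) ^ 2) = _
    field_simp
    ring
  rw [e] at h2
  exact h2

lemma ae_closure {F : Type*} [TopologicalSpace F] [MeasurableSpace F] [BorelSpace F]
    (μ : Measure F) [IsProbabilityMeasure μ] (X : Set F) (h : μ X = 1) :
    ∀ᵐ x ∂μ, x ∈ closure X := by
  have : μ (closure X) = 1 := le_antisymm prob_le_one (h ▸ measure_mono subset_closure)
  exact (prob_compl_eq_zero_iff isClosed_closure.measurableSet).2 this

end EnergyAux

/-- Concentration of the energy score empirical loss (Lemma in Appendix A.2 of the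
paper).  The data space `X ⊆ ℝ^d` is bounded with `sup_{x,y∈X} ‖x-y‖₂ ≤ B < ∞`, the
distributions `Pθ` and `P0` are supported on `X`, and `β ∈ (0,2)`.  The empirical
loss `L` defining the Energy Score posterior concentrates around the divergence
`De` (squared energy distance) between `Pθ` and `P0`: for `Y₁,…,Y_n` i.i.d. with
law `P0` and any `δ ∈ (0,1]`, with probability at least `1 - δ`,
`|L(θ, Y) - De| ≤ √(-(32 B^(2β)/n) log(δ/2))`. -/
theorem energy_score_empirical_loss_concentration
    {d : ℕ}
    (X : Set (EuclideanSpace ℝ (Fin d)))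
    (Pθ P0 : Measure (EuclideanSpace ℝ (Fin d)))
    [IsProbabilityMeasure Pθ] [IsProbabilityMeasure P0]
    (hPθ_supp : Pθ X = 1) (hP0_supp : P0 X = 1)
    (B : ℝ) (hB : 0 ≤ B)
    (hX_bdd : ∀ x ∈ X, ∀ y ∈ X, ‖x - y‖ ≤ B)
    (β : ℝ) (hβ : β ∈ Set.Ioo (0 : ℝ) 2)
    (n : ℕ) (hn : 2 ≤ n)
    (L : (Fin n → EuclideanSpace ℝ (Fin d)) → ℝ)
    (hL : ∀ ys, L ys =
      (2 / (n : ℝ)) * ∑ i, (∫ x, ‖x - ys i‖ ^ β ∂Pθ)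
        - ((n : ℝ) * ((n : ℝ) - 1))⁻¹ *
            ∑ i, ∑ j ∈ Finset.univ.erase i, ‖ys i - ys j‖ ^ β
        - ∫ x, ∫ x', ‖x - x'‖ ^ β ∂Pθ ∂Pθ)
    (De : ℝ)
    (hDe : De =
      2 * (∫ x, ∫ y, ‖x - y‖ ^ β ∂P0 ∂Pθ)
        - (∫ x, ∫ x', ‖x - x'‖ ^ β ∂Pθ ∂Pθ)
        - ∫ y, ∫ y', ‖y - y'‖ ^ β ∂P0 ∂P0)
    (δ : ℝ) (hδ : δ ∈ Set.Ioc (0 : ℝ) 1) :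
    ENNReal.ofReal (1 - δ) ≤
      (Measure.pi fun _ : Fin n => P0)
        {ys : Fin n → EuclideanSpace ℝ (Fin d) |
          |L ys - De| ≤ Real.sqrt (-(32 * B ^ (2 * β) / (n : ℝ)) * Real.log (δ / 2))} := by
  have hβ0 : 0 < β := hβ.1
  set K : ℝ := B ^ β with hK
  have hK0 : 0 ≤ K := Real.rpow_nonneg hB β
  set k : EuclideanSpace ℝ (Fin d) → EuclideanSpace ℝ (Fin d) → ℝ :=
    fun x y => min (‖x - y‖ ^ β) K with hkdef
  have hk : Measurable (Function.uncurry k) := by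
    simp only [hkdef, Function.uncurry_def]
    fun_prop
  have hk0 : ∀ x y, 0 ≤ k x y := fun x y => le_min (by positivity) hK0
  have hkK : ∀ x y, k x y ≤ K := fun x y => min_le_right _ _
  have hcl : ∀ x ∈ closure X, ∀ y ∈ closure X, ‖x - y‖ ≤ B := by
    intro x hx y hy
    have hbd : Bornology.IsBounded X := by
      refine Metric.isBounded_iff.2 ⟨B, fun x hx y hy => ?_⟩
      rw [dist_eq_norm]; exact hX_bdd x hx y hy
    rw [← dist_eq_norm]
    refine (Metric.dist_le_diam_of_mem hbd.closure hx hy).trans ?_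
    rw [Metric.diam_closure]
    refine Metric.diam_le_of_forall_dist_le hB fun x hx y hy => ?_
    rw [dist_eq_norm]; exact hX_bdd x hx y hy
  have hkeq : ∀ x ∈ closure X, ∀ y ∈ closure X, ‖x - y‖ ^ β = k x y := by
    intro x hx y hy
    exact (min_eq_left (Real.rpow_le_rpow (norm_nonneg _) (hcl x hx y hy) hβ0.le)).symm
  have aθ := EnergyAux.ae_closure Pθ X hPθ_supp
  have a0 := EnergyAux.ae_closure P0 X hP0_supp
  have dbl : ∀ (μ ν : Measure (EuclideanSpace ℝ (Fin d))), (∀ᵐ x ∂μ, x ∈ closure X) →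
      (∀ᵐ x ∂ν, x ∈ closure X) →
      ∫ x, ∫ y, ‖x - y‖ ^ β ∂ν ∂μ = ∫ x, ∫ y, k x y ∂ν ∂μ := by
    intro μ ν hμ hν
    refine integral_congr_ae ?_
    filter_upwards [hμ] with x hx
    refine integral_congr_ae ?_
    filter_upwards [hν] with y hy
    exact hkeq x hx y hy
  have hLk : ∀ᵐ ys ∂(Measure.pi fun _ : Fin n => P0), L ys = EnergyAux.loss k Pθ n ys := by
    have hall : ∀ᵐ ys ∂(Measure.pi fun _ : Fin n => P0), ∀ i, ys i ∈ closure X :=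
      ae_all_iff.2 fun i => Measure.tendsto_eval_ae_ae.eventually a0
    filter_upwards [hall] with ys hys
    rw [hL, EnergyAux.loss, dbl _ _ aθ aθ]
    congr 2
    · congr 1
      refine Finset.sum_congr rfl fun i _ => integral_congr_ae ?_
      filter_upwards [aθ] with x hx
      exact hkeq x hx _ (hys i)
    · congr 1
      exact Finset.sum_congr rfl fun i _ => Finset.sum_congr rfl fun j _ =>
        hkeq _ (hys i) _ (hys j)
  rw [dbl _ _ aθ a0, dbl _ _ aθ aθ, dbl _ _ a0 a0] at hDe
  have main := EnergyAux.loss_conc k hk K hk0 hkK Pθ P0 n hn δ hδ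
  have hB2 : B ^ (2 * β) = K ^ 2 := by
    rw [hK, mul_comm, Real.rpow_mul hB]; norm_num
  rw [hB2]
  refine main.trans (measure_mono_ae ?_)
  filter_upwards [hLk] with ys hys h
  change |L ys - De| ≤ _
  rw [hys, hDe]
  exact h
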